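/- arXiv:2312.03091 — 8 statements merged into one kernel-verified Lean document; each statement's English description precedes it below -/
import Mathlib

section
/- Let n ≥ 1 and let x_k = cos(kπ/n), k = 0, 1, ..., n, be the extreme points of the Chebyshev polynomial T_n on [-1,1], with ℓ_i the fundamental Lagrange interpolation polynomials for these n+1 points. Then for every real x_0 with |x_0| > 1, (∑_{i=0}^n |ℓ_i(x_0)|)² = T_n(x_0)². -/
open Polynomial Real

open Polynomial.Chebyshev in
lemma neg_one_pow_mul_nodalWeight_node_pos (n : ℕ) (i : Fin (n + 1)) :
    0 < (-1) ^ (i : ℕ) *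
      Lagrange.nodalWeight Finset.univ (fun k : Fin (n + 1) => node n k) i := by
  have h := inv_pos.mpr (zero_lt_prod_node_sub_node (Nat.lt_succ_iff.mp i.is_lt))
  rw [mul_inv, ← inv_pow, inv_neg_one] at h
  refine h.trans_eq (congrArg _ ?_)
  rw [Lagrange.nodalWeight, Finset.prod_inv_distrib]
  refine congrArg _ (Eq.symm ?_)
  refine Finset.prod_bij (fun k _ => (k : ℕ)) ?_ ?_ ?_ ?_
  · intro k hk
    simpa [Fin.ext_iff, Nat.lt_succ_iff, Fin.is_le] using hk
  · intro a _ b _ hab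
    exact Fin.ext hab
  · intro k hk
    rw [Finset.mem_erase, Finset.mem_range] at hk
    exact ⟨⟨k, hk.2⟩, by simpa [Fin.ext_iff] using hk.1, rfl⟩
  · simp

open Polynomial.Chebyshev in
lemma injective_node (n : ℕ) : Function.Injective (fun k : Fin (n + 1) => node n k) := by
  intro a b hab
  exact Fin.ext ((strictAntiOn_node n).injOn (by simp [a.is_le]) (by simp [b.is_le]) hab)

open Polynomial.Chebyshev in
/-- Outside `[-1, 1]` the Lebesgue function of the Chebyshev extreme points is `|T n|`. -/
lemma sum_abs_eval_basis_node (n : ℕ) {x : ℝ} (hx : 1 < |x|) :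
    ∑ i : Fin (n + 1),
        |(Lagrange.basis Finset.univ (fun k : Fin (n + 1) => node n k) i).eval x| =
      |(T ℝ n).eval x| := by
  set v : Fin (n + 1) → ℝ := fun k => node n k
  have hv (i : Fin (n + 1)) : |v i| ≤ 1 := abs_le.mpr node_mem_Icc
  have hne (i : Fin (n + 1)) : x ≠ v i := fun h => (h ▸ hx).not_ge (hv i)
  have hT : (T ℝ n).eval x = (Lagrange.nodal Finset.univ v).eval x *
      ∑ i, Lagrange.nodalWeight Finset.univ v i * (x - v i)⁻¹ * (-1) ^ (i : ℕ) := by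
    rw [← Lagrange.eval_interpolate_not_at_node _ (fun i _ => hne i)]
    congr 1
    refine Lagrange.eq_interpolate_of_eval_eq _ (injective_node n).injOn ?_ fun i _ => ?_
    · rw [degree_T, Int.natAbs_natCast, Finset.card_univ, Fintype.card_fin, Nat.cast_lt]
      exact n.lt_succ_self
    · exact eval_T_real_node (Finset.mem_Iic.mpr i.is_le)
  have habs (i : Fin (n + 1)) : |Lagrange.nodalWeight Finset.univ v i| =
      (-1) ^ (i : ℕ) * Lagrange.nodalWeight Finset.univ v i := by
    rw [← abs_of_pos (neg_one_pow_mul_nodalWeight_node_pos n i), abs_mul, abs_neg_one_pow,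
      one_mul]
  simp_rw [Lagrange.eval_basis_not_at_node (Finset.mem_univ _) (hne _), abs_mul, habs]
  rw [hT, abs_mul, ← Finset.mul_sum]
  congr 1
  rcases lt_abs.mp hx with h | h
  · have hpos (i : Fin (n + 1)) : 0 < (x - v i)⁻¹ :=
      inv_pos.mpr (by linarith [(abs_le.mp (hv i)).2])
    rw [abs_of_nonneg]
    · exact Finset.sum_congr rfl fun i _ => by rw [abs_of_pos (hpos i)]; ring
    · refine Finset.sum_nonneg fun i _ => ?_
      have := mul_pos (neg_one_pow_mul_nodalWeight_node_pos n i) (hpos i)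
      linarith
  · have hneg (i : Fin (n + 1)) : (x - v i)⁻¹ < 0 :=
      inv_lt_zero.mpr (by linarith [(abs_le.mp (hv i)).1])
    rw [abs_of_nonpos, ← Finset.sum_neg_distrib]
    · exact Finset.sum_congr rfl fun i _ => by rw [abs_of_neg (hneg i)]; ring
    · refine Finset.sum_nonpos fun i _ => ?_
      have := mul_neg_of_pos_of_neg (neg_one_pow_mul_nodalWeight_node_pos n i) (hneg i)
      linarith

/-- **Hoel–Levine identity at the Chebyshev extreme points (equation (2.2)).**
For `n ≥ 1`, let `x k = cos(kπ/n)`, `k = 0,…,n`, be the extreme points of the Chebyshev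
polynomial `T n` on `[-1,1]` and `ℓ i` the corresponding fundamental Lagrange polynomials.
Then for every real `x₀` with `|x₀| > 1`, `(∑ᵢ |ℓᵢ(x₀)|)² = (T n (x₀))²`. -/
theorem chebyshev_lebesgue_function_sq (n : ℕ) (hn : 1 ≤ n) (x0 : ℝ) (hx0 : 1 < |x0|) :
    (∑ i : Fin (n + 1),
        |(Lagrange.basis Finset.univ
            (fun k : Fin (n + 1) => Real.cos (k * Real.pi / n)) i).eval x0|) ^ 2 =
      ((Polynomial.Chebyshev.T ℝ n).eval x0) ^ 2 := by
  have h := sum_abs_eval_basis_node n hx0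
  simp only [Polynomial.Chebyshev.node] at h
  rw [h, sq_abs]
end

section
/- Let V ∈ ℝ^{M×N} with M ≥ N have full rank N, let p ∈ ℝ^N, let w ∈ ℝ^M be a vector with all w_i > 0, and set W = diag(w) and G = V^t W V (which is invertible). Then for every c ∈ ℝ^M with V^t c = p, one has p^t G^{-1} p ≤ ∑_{i=1}^M c_i² / w_i. In particular, if c ∈ ℝ^M satisfies V^t c = p and all c_i ≠ 0, then taking w = |c|/‖c‖₁ gives p^t G^{-1} p ≤ ‖c‖₁², where ‖c‖₁ = ∑_i |c_i|. -/
open Matrix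

/-- A matrix whose rank equals its number of columns acts injectively on column vectors. -/
theorem Matrix.mulVec_injective_of_rank_eq {M N : ℕ} {V : Matrix (Fin M) (Fin N) ℝ}
    (hV : V.rank = N) : Function.Injective V.mulVec := by
  have h := LinearMap.finrank_range_add_finrank_ker V.mulVecLin
  rw [← Matrix.rank, hV, Module.finrank_fin_fun, Nat.add_eq_left,
    Submodule.finrank_eq_zero] at h
  exact LinearMap.ker_eq_bot.mp h

/-- Full column rank and positive weights make the weighted Gram matrix invertible. -/
theorem Matrix.isUnit_weighted_gram {M N : ℕ} {V : Matrix (Fin M) (Fin N) ℝ}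
    (hV : V.rank = N) {w : Fin M → ℝ} (hw : ∀ i, 0 < w i) :
    IsUnit (Vᵀ * Matrix.diagonal w * V) := by
  have h := (Matrix.PosDef.diagonal hw).conjTranspose_mul_mul_same
    (Matrix.mulVec_injective_of_rank_eq hV)
  rw [Matrix.conjTranspose_eq_transpose_of_trivial] at h
  exact h.isUnit

/-- Completing the square: the inverse Gram quadratic form is bounded by every weighted sum of
squares of coefficients representing the same functional. -/
theorem Matrix.dotProduct_inv_weighted_gram_mulVec_le {M N : ℕ} {V : Matrix (Fin M) (Fin N) ℝ}
    {w : Fin M → ℝ} (hw : ∀ i, 0 < w i) (hG : IsUnit (Vᵀ * Matrix.diagonal w * V))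
    (c : Fin M → ℝ) :
    (Vᵀ *ᵥ c) ⬝ᵥ ((Vᵀ * Matrix.diagonal w * V)⁻¹ *ᵥ (Vᵀ *ᵥ c)) ≤ ∑ i, c i ^ 2 / w i := by
  set x := (Vᵀ * Matrix.diagonal w * V)⁻¹ *ᵥ (Vᵀ *ᵥ c) with hx
  have hGx : (Vᵀ * Matrix.diagonal w * V) *ᵥ x = Vᵀ *ᵥ c := by
    rw [hx, Matrix.mulVec_mulVec,
      Matrix.mul_nonsing_inv _ ((Matrix.isUnit_iff_isUnit_det _).mp hG), Matrix.one_mulVec]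
  have transpose_dot (b : Fin M → ℝ) : (Vᵀ *ᵥ b) ⬝ᵥ x = ∑ i, b i * (V *ᵥ x) i := by
    rw [Matrix.mulVec_transpose, ← Matrix.dotProduct_mulVec, dotProduct]
  have hc := transpose_dot c
  have hu : (Vᵀ *ᵥ c) ⬝ᵥ x = ∑ i, w i * (V *ᵥ x) i * (V *ᵥ x) i := by
    rw [← hGx, ← Matrix.mulVec_mulVec, ← Matrix.mulVec_mulVec, transpose_dot]
    simp only [Matrix.mulVec_diagonal]
  have hsq : 0 ≤ ∑ i, (c i ^ 2 / w i - 2 * (c i * (V *ᵥ x) i)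
      + w i * (V *ᵥ x) i * (V *ᵥ x) i) := by
    refine Finset.sum_nonneg fun i _ => ?_
    have hi := hw i
    have : c i ^ 2 / w i - 2 * (c i * (V *ᵥ x) i) + w i * (V *ᵥ x) i * (V *ᵥ x) i
        = (c i - w i * (V *ᵥ x) i) ^ 2 / w i := by
      field_simp
      ring
    rw [this]
    positivity
  rw [Finset.sum_add_distrib, Finset.sum_sub_distrib, ← Finset.mul_sum, ← hc, ← hu] at hsq
  linarith

/-- **Rectangular case: lower bound for the prediction variance.**
Let `V ∈ ℝ^{M×N}` (`M ≥ N`) have full rank `N` and `p ∈ ℝ^N`.  For any `w` with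
positive entries, `G = Vᵗ (diag w) V` is invertible and for every `c` with `Vᵗ c = p`
one has `pᵗ G⁻¹ p ≤ ∑ᵢ cᵢ²/wᵢ`.  In particular, if `Vᵗ c = p` and all `cᵢ ≠ 0`,
taking `w = |c|/‖c‖₁` gives `pᵗ G⁻¹ p ≤ ‖c‖₁²`. -/
theorem gram_quadratic_form_le_weighted_sum (M N : ℕ) (hMN : N ≤ M)
    (V : Matrix (Fin M) (Fin N) ℝ) (hV : V.rank = N)
    (p : Fin N → ℝ) :
    (∀ w : Fin M → ℝ, (∀ i, 0 < w i) →
      IsUnit (Vᵀ * Matrix.diagonal w * V) ∧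
      ∀ c : Fin M → ℝ, Vᵀ *ᵥ c = p →
        p ⬝ᵥ ((Vᵀ * Matrix.diagonal w * V)⁻¹ *ᵥ p) ≤ ∑ i, (c i) ^ 2 / w i) ∧
    (∀ c : Fin M → ℝ, Vᵀ *ᵥ c = p → (∀ i, c i ≠ 0) →
      p ⬝ᵥ ((Vᵀ * Matrix.diagonal (fun i => |c i| / ∑ j, |c j|) * V)⁻¹ *ᵥ p) ≤
        (∑ i, |c i|) ^ 2) := by
  have bound (w : Fin M → ℝ) (hw : ∀ i, 0 < w i) (c : Fin M → ℝ) (hc : Vᵀ *ᵥ c = p) :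
      p ⬝ᵥ ((Vᵀ * Matrix.diagonal w * V)⁻¹ *ᵥ p) ≤ ∑ i, (c i) ^ 2 / w i := by
    subst hc
    exact Matrix.dotProduct_inv_weighted_gram_mulVec_le hw (Matrix.isUnit_weighted_gram hV hw) c
  refine ⟨fun w hw => ⟨Matrix.isUnit_weighted_gram hV hw, bound w hw⟩, fun c hc hc0 => ?_⟩
  have hpos (i : Fin M) : 0 < |c i| / ∑ j, |c j| :=
    div_pos (abs_pos.mpr (hc0 i))
      (Finset.sum_pos (fun j _ => abs_pos.mpr (hc0 j)) ⟨i, Finset.mem_univ i⟩)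
  refine (bound _ hpos c hc).trans_eq ?_
  rw [sq (∑ i, |c i|), Finset.sum_mul]
  refine Finset.sum_congr rfl fun i _ => ?_
  have hi : |c i| ≠ 0 := abs_ne_zero.mpr (hc0 i)
  rw [← sq_abs, div_div_eq_mul_div, sq, mul_assoc, mul_div_assoc, mul_div_cancel_left₀ _ hi]
end

section
/- Let V ∈ ℝ^{M×N} have full rank N and let p ∈ ℝ^N be nonzero. Suppose w* minimizes K(w) = p^t (V^t diag(w) V)^{-1} p over all probability weight vectors w ∈ ℝ^M (w_i ≥ 0, ∑ w_i = 1) for which G(w) = V^t diag(w) V is invertible, and that G(w*) is invertible. Then for every index k with w*_k ≠ 0, (R_k^t G(w*)^{-1} p)² = K(w*), where R_k is the k-th column of V^t; equivalently R_k^t G(w*)^{-1} p = ± √(K(w*)) for every k in the support of w*. -/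
open Matrix

/-- Invertibility of a rank-one update, phrased through a solution `u` of `G u = R`. -/
lemma isUnit_add_smul_vecMulVec {n : Type*} [Fintype n] [DecidableEq n]
    {G : Matrix n n ℝ} (hG : IsUnit G) {R u : n → ℝ} (hu : G *ᵥ u = R) {s : ℝ}
    (hs : 1 + s * (R ⬝ᵥ u) ≠ 0) : IsUnit (G + s • vecMulVec R R) := by
  have hinj : Function.Injective G.mulVec := mulVec_injective_iff_isUnit.2 hG
  rw [← mulVec_injective_iff_isUnit]
  refine (injective_iff_map_eq_zero (G + s • vecMulVec R R).mulVecLin).2 fun y hy => ?_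
  have hGy : G *ᵥ y + (s * (R ⬝ᵥ y)) • R = 0 := by
    simpa [add_mulVec, smul_mulVec, vecMulVec_mulVec, smul_smul] using hy
  have hy' : y + (s * (R ⬝ᵥ y)) • u = 0 := by
    apply hinj
    simpa [mulVec_add, mulVec_smul, hu] using hGy
  have hdot : (R ⬝ᵥ y) * (1 + s * (R ⬝ᵥ u)) = 0 := by
    have h := congrArg (fun v => R ⬝ᵥ v) hy'
    simp only [dotProduct_add, dotProduct_smul, dotProduct_zero, smul_eq_mul] at h
    linarith
  have hRy : R ⬝ᵥ y = 0 := (mul_eq_zero.1 hdot).resolve_right hs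
  simpa [hRy] using hy'

/-- The Sherman–Morrison formula for the quadratic form of the inverse of a symmetric matrix. -/
lemma dotProduct_inv_add_smul_vecMulVec_mulVec {n : Type*} [Fintype n] [DecidableEq n]
    {G : Matrix n n ℝ} (hG : IsUnit G) (hsymm : Gᵀ = G) (R p : n → ℝ) {s : ℝ}
    (hs : 1 + s * (R ⬝ᵥ (G⁻¹ *ᵥ R)) ≠ 0) :
    p ⬝ᵥ ((G + s • vecMulVec R R)⁻¹ *ᵥ p) =
      p ⬝ᵥ (G⁻¹ *ᵥ p) - s * (R ⬝ᵥ (G⁻¹ *ᵥ p)) ^ 2 / (1 + s * (R ⬝ᵥ (G⁻¹ *ᵥ R))) := by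
  have hdet : IsUnit G.det := (isUnit_iff_isUnit_det G).1 hG
  have hinv (v : n → ℝ) : G *ᵥ (G⁻¹ *ᵥ v) = v := by
    rw [mulVec_mulVec, mul_nonsing_inv _ hdet, one_mulVec]
  have hupd := (isUnit_iff_isUnit_det _).1 (isUnit_add_smul_vecMulVec hG (hinv R) hs)
  have hcomm : p ⬝ᵥ (G⁻¹ *ᵥ R) = R ⬝ᵥ (G⁻¹ *ᵥ p) := by
    rw [dotProduct_mulVec, ← mulVec_transpose, transpose_nonsing_inv, hsymm, dotProduct_comm]
  set a := R ⬝ᵥ (G⁻¹ *ᵥ R) with ha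
  set c := R ⬝ᵥ (G⁻¹ *ᵥ p) with hc
  have hsol : (G + s • vecMulVec R R) *ᵥ
      (G⁻¹ *ᵥ p - (s * c / (1 + s * a)) • (G⁻¹ *ᵥ R)) = p := by
    simp only [add_mulVec, smul_mulVec, vecMulVec_mulVec, mulVec_sub, mulVec_smul, hinv, ← ha, ← hc]
    ext i
    simp only [Pi.add_apply, Pi.sub_apply, Pi.smul_apply, smul_eq_mul, MulOpposite.smul_eq_mul_unop,
      MulOpposite.unop_op]
    field_simp
    ring
  have hx : (G + s • vecMulVec R R)⁻¹ *ᵥ p =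
      G⁻¹ *ᵥ p - (s * c / (1 + s * a)) • (G⁻¹ *ᵥ R) := by
    conv_lhs => rw [← hsol]
    rw [mulVec_mulVec, nonsing_inv_mul _ hupd, one_mulVec]
  rw [hx, dotProduct_sub, dotProduct_smul, hcomm, smul_eq_mul]
  ring

/-- The Gram matrix after moving mass towards the `k`-th point is a scaled rank-one update. -/
lemma gram_smul_add_single {m n : Type*} [Fintype m] [DecidableEq m]
    (V : Matrix m n ℝ) (w : m → ℝ) (k : m) (r s : ℝ) :
    Vᵀ * diagonal (r • (w + s • Pi.single k 1)) * V =
      r • (Vᵀ * diagonal w * V + s • vecMulVec (V k) (V k)) := by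
  have hsingle : Vᵀ * diagonal (Pi.single k (1 : ℝ)) * V = vecMulVec (V k) (V k) := by
    ext i j
    rw [Matrix.mul_apply]
    simp [mul_diagonal, vecMulVec_apply, Pi.single_apply]
  have hadd : diagonal (r • (w + s • Pi.single k 1)) =
      r • (diagonal w + s • diagonal (Pi.single k (1 : ℝ))) := by
    rw [diagonal_smul, ← diagonal_smul s, diagonal_add]
    rfl
  rw [hadd, Matrix.mul_smul, Matrix.smul_mul, Matrix.mul_add, Matrix.add_mul, Matrix.mul_smul,
    Matrix.smul_mul, hsingle]

/-- A real quadratic without constant term that is nonnegative near `0` has no linear term. -/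
lemma eq_zero_of_linear_add_sq_nonneg {D E δ : ℝ} (hδ : 0 < δ)
    (h : ∀ s, |s| < δ → 0 ≤ s * D + s ^ 2 * E) : D = 0 := by
  have hmin : IsLocalMin (fun s : ℝ => s * D + s ^ 2 * E) 0 := by
    filter_upwards [Metric.ball_mem_nhds (0 : ℝ) hδ] with s hs
    simpa using h s (by simpa using hs)
  have hderiv : HasDerivAt (fun s : ℝ => s * D + s ^ 2 * E) D 0 := by
    simpa using ((hasDerivAt_id (0 : ℝ)).mul_const D).fun_add
      (((hasDerivAt_id (0 : ℝ)).fun_pow 2).mul_const E)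
  exact hmin.hasDerivAt_eq_zero hderiv

/-- **First-order optimality condition (equation (3.5)).**
Let `V ∈ ℝ^{M×N}` have full rank `N` and `p ∈ ℝ^N` nonzero.  If `w*` minimizes
`K w = pᵗ (Vᵗ (diag w) V)⁻¹ p` over all probability weight vectors with invertible
Gram matrix, and `G(w*)` is invertible, then for every `k` in the support of `w*`,
`(R_kᵗ G(w*)⁻¹ p)² = K(w*)`, where `R_k` is the `k`-th column of `Vᵗ`. -/
theorem optimality_condition (M N : ℕ)
    (V : Matrix (Fin M) (Fin N) ℝ) (hV : V.rank = N)
    (p : Fin N → ℝ) (hp : p ≠ 0)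
    (wstar : Fin M → ℝ) (hw0 : ∀ i, 0 ≤ wstar i) (hw1 : (∑ i, wstar i) = 1)
    (hG : IsUnit (Vᵀ * Matrix.diagonal wstar * V))
    (hmin : ∀ w : Fin M → ℝ, (∀ i, 0 ≤ w i) → (∑ i, w i) = 1 →
      IsUnit (Vᵀ * Matrix.diagonal w * V) →
      p ⬝ᵥ ((Vᵀ * Matrix.diagonal wstar * V)⁻¹ *ᵥ p) ≤
        p ⬝ᵥ ((Vᵀ * Matrix.diagonal w * V)⁻¹ *ᵥ p)) :
    ∀ k : Fin M, wstar k ≠ 0 →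
      ((fun j => V k j) ⬝ᵥ ((Vᵀ * Matrix.diagonal wstar * V)⁻¹ *ᵥ p)) ^ 2 =
        p ⬝ᵥ ((Vᵀ * Matrix.diagonal wstar * V)⁻¹ *ᵥ p) := by
  intro k hk
  have hdet := (isUnit_iff_isUnit_det _).1 hG
  have hsymm : (Vᵀ * diagonal wstar * V)ᵀ = Vᵀ * diagonal wstar * V := by
    simp [transpose_mul, Matrix.mul_assoc]
  have hpos : 0 < wstar k := lt_of_le_of_ne (hw0 k) hk.symm
  have hle : wstar k ≤ 1 := hw1 ▸ Finset.single_le_sum (fun i _ => hw0 i) (Finset.mem_univ k)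
  have hgram (r s : ℝ) := gram_smul_add_single V wstar k r s
  change (V k ⬝ᵥ _) ^ 2 = _
  generalize Vᵀ * diagonal wstar * V = G at *
  set a := V k ⬝ᵥ (G⁻¹ *ᵥ V k) with ha
  set c := V k ⬝ᵥ (G⁻¹ *ᵥ p) with hc
  set K := p ⬝ᵥ (G⁻¹ *ᵥ p) with hK
  suffices h : K - c ^ 2 = 0 by linarith
  refine eq_zero_of_linear_add_sq_nonneg (E := K * a - c ^ 2)
    (δ := min (wstar k) (1 / (|a| + 1))) (by positivity) fun s hs => ?_
  obtain ⟨hs₁, hs₂⟩ := lt_min_iff.1 hs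
  have hs1 : 0 < 1 + s := by linarith [neg_abs_le s]
  have hsa : 0 < 1 + s * a := by
    have h : |s| * (|a| + 1) < 1 := (lt_div_iff₀ (by positivity)).1 hs₂
    have := neg_abs_le (s * a)
    rw [abs_mul] at this
    nlinarith [abs_nonneg s]
  have hne : (1 + s)⁻¹ ≠ 0 := (inv_pos.2 hs1).ne'
  have hunit : IsUnit (G + s • vecMulVec (V k) (V k)) :=
    isUnit_add_smul_vecMulVec hG
      (by rw [mulVec_mulVec, mul_nonsing_inv _ hdet, one_mulVec]) hsa.ne'
  have hw := hmin ((1 + s)⁻¹ • (wstar + s • Pi.single k 1)) (fun i => ?_) ?_ ?_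
  · have hinv : ((1 + s)⁻¹ • (G + s • vecMulVec (V k) (V k)))⁻¹ =
        (1 + s) • (G + s • vecMulVec (V k) (V k))⁻¹ := by
      apply inv_eq_right_inv
      rw [smul_mul_smul_comm, inv_mul_cancel₀ hs1.ne', one_smul,
        mul_nonsing_inv _ ((isUnit_iff_isUnit_det _).1 hunit)]
    rw [hgram, hinv, smul_mulVec, dotProduct_smul,
      dotProduct_inv_add_smul_vecMulVec_mulVec hG hsymm _ _ hsa.ne', smul_eq_mul,
      ← ha, ← hc, ← hK] at hw
    have hmul := mul_le_mul_of_nonneg_right hw hsa.le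
    have heq : (1 + s) * (K - s * c ^ 2 / (1 + s * a)) * (1 + s * a) =
        (1 + s) * (K * (1 + s * a) - s * c ^ 2) := by
      field_simp
    rw [heq] at hmul
    have hfac : (1 + s) * (K * (1 + s * a) - s * c ^ 2) - K * (1 + s * a) =
        s * (K - c ^ 2) + s ^ 2 * (K * a - c ^ 2) := by
      ring
    linarith
  · refine mul_nonneg (inv_pos.2 hs1).le ?_
    by_cases hi : i = k
    · subst hi
      simp
      linarith [neg_abs_le s]
    · simpa [hi] using hw0 i
  · simp [← Finset.mul_sum, Finset.sum_add_distrib, hw1, hs1.ne']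
  · rw [hgram]
    exact (isUnit_smul_iff (Units.mk0 _ hne) _).2 hunit
end

section
/- Let V ∈ ℝ^{M×N} (M ≥ N) have full rank N and let p ∈ ℝ^N be nonzero. Suppose w* is a probability weight vector (w*_i ≥ 0, ∑ w*_i = 1) that minimizes K(w) = p^t (V^t diag(w) V)^{-1} p over all probability weight vectors for which the Gram matrix is invertible, and that G(w*) = V^t diag(w*) V is invertible. Then there exists c ∈ ℝ^M such that: V^t c = p; ‖c‖₁ = √(K(w*)); w*_i = |c_i| / ‖c‖₁ for every i; and ‖c‖₁ ≤ ‖c'‖₁ for every c' ∈ ℝ^M with V^t c' = p, i.e., c is a minimizer of the ℓ¹ norm over the affine solution set of V^t c = p. -/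
open Matrix

section WeightedGram

variable {m n : Type*} [Fintype m] [DecidableEq m] [Fintype n]

theorem weightedGram_mulVec (V : Matrix m n ℝ) (w : m → ℝ) (x : n → ℝ) :
    (Vᵀ * Matrix.diagonal w * V) *ᵥ x = Vᵀ *ᵥ (fun j => w j * (V *ᵥ x) j) := by
  rw [← mulVec_mulVec, ← mulVec_mulVec]
  congr 1
  ext j
  rw [mulVec_diagonal]

theorem weightedGram_posSemidef (V : Matrix m n ℝ) {w : m → ℝ} (hw : ∀ i, 0 ≤ w i) :
    (Vᵀ * Matrix.diagonal w * V).PosSemidef := by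
  have h := (PosSemidef.diagonal (n := m) (d := w) hw).conjTranspose_mul_mul_same V
  rwa [conjTranspose_eq_transpose_of_trivial] at h

/-- Moving mass `t` of the weights to the point `i` adds a rank-one term to the Gram matrix. -/
theorem weightedGram_mix (V : Matrix m n ℝ) (w : m → ℝ) (i : m) (t : ℝ) :
    Vᵀ * Matrix.diagonal ((1 - t) • w + t • Pi.single i 1) * V =
      (1 - t) • (Vᵀ * Matrix.diagonal w * V) + t • vecMulVec (V i) (V i) := by
  have h : Vᵀ * Matrix.diagonal (Pi.single i (1 : ℝ)) * V = vecMulVec (V i) (V i) := by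
    ext a b
    simp [Matrix.mul_apply, vecMulVec_apply, Matrix.diagonal_apply, Pi.single_apply]
  have hd : Matrix.diagonal ((1 - t) • w + t • Pi.single i 1) =
      (1 - t) • Matrix.diagonal w + t • Matrix.diagonal (Pi.single i (1 : ℝ)) := by
    rw [← diagonal_smul, ← diagonal_smul, diagonal_add]
    rfl
  rw [← h, hd]
  simp [Matrix.mul_add, Matrix.add_mul]

/-- If `p ⬝ᵥ G⁻¹ p` does not decrease along `(1 - t) G + t v vᵗ`, `0 < t < 1`, then
`(v ⬝ᵥ G⁻¹ p) ^ 2 ≤ p ⬝ᵥ G⁻¹ p`. -/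
theorem Matrix.PosDef.sq_dotProduct_inv_mulVec_le [DecidableEq n] {G : Matrix n n ℝ} (hG : G.PosDef)
    (p v : n → ℝ)
    (hmin : ∀ t : ℝ, 0 < t → t < 1 →
      p ⬝ᵥ (G⁻¹ *ᵥ p) ≤ p ⬝ᵥ (((1 - t) • G + t • vecMulVec v v)⁻¹ *ᵥ p)) :
    (v ⬝ᵥ (G⁻¹ *ᵥ p)) ^ 2 ≤ p ⬝ᵥ (G⁻¹ *ᵥ p) := by
  have hdet : IsUnit G.det := (isUnit_iff_isUnit_det G).1 hG.isUnit
  have hsymm : ∀ x y : n → ℝ, x ⬝ᵥ (G⁻¹ *ᵥ y) = y ⬝ᵥ (G⁻¹ *ᵥ x) := by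
    intro x y
    have h : (G⁻¹)ᵀ = G⁻¹ := by
      have := hG.inv.isHermitian.eq
      rwa [conjTranspose_eq_transpose_of_trivial] at this
    rw [dotProduct_mulVec, ← mulVec_transpose, h, dotProduct_comm]
  have hnonneg : ∀ x : n → ℝ, 0 ≤ x ⬝ᵥ (G⁻¹ *ᵥ x) := fun x => by
    simpa using hG.inv.posSemidef.dotProduct_mulVec_nonneg x
  set K := p ⬝ᵥ (G⁻¹ *ᵥ p) with hK
  set u := v ⬝ᵥ (G⁻¹ *ᵥ p) with hu
  set h := v ⬝ᵥ (G⁻¹ *ᵥ v) with hh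
  have hK0 : 0 ≤ K := hnonneg p
  have hh0 : 0 ≤ h := hnonneg v
  have key : ∀ t : ℝ, 0 < t → t < 1 → u ^ 2 ≤ K * (1 - t + t * h) := by
    intro t ht0 ht1
    have hvv : (vecMulVec v v).PosSemidef := by
      simpa using posSemidef_vecMulVec_self_star v
    have hpd : ((1 - t) • G + t • vecMulVec v v).PosDef :=
      (hG.smul (sub_pos.2 ht1)).add_posSemidef (hvv.smul ht0.le)
    have hle := hmin t ht0 ht1
    set a := ((1 - t) • G + t • vecMulVec v v)⁻¹ *ᵥ p with ha
    have hp : (1 - t) • (G *ᵥ a) + (t * (v ⬝ᵥ a)) • v = p := by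
      have : ((1 - t) • G + t • vecMulVec v v) *ᵥ a = p := by
        rw [ha, mulVec_mulVec, mul_nonsing_inv _ ((isUnit_iff_isUnit_det _).1 hpd.isUnit),
          one_mulVec]
      rw [add_mulVec, smul_mulVec, smul_mulVec, vecMulVec_mulVec] at this
      simpa [mul_smul] using this
    have hGp : G⁻¹ *ᵥ p = (1 - t) • a + (t * (v ⬝ᵥ a)) • (G⁻¹ *ᵥ v) := by
      conv_lhs => rw [← hp]
      rw [mulVec_add, mulVec_smul, mulVec_smul, mulVec_mulVec, nonsing_inv_mul _ hdet,
        one_mulVec]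
    have h1 : u = (1 - t) * (v ⬝ᵥ a) + t * (v ⬝ᵥ a) * h := by
      rw [hu, hGp, dotProduct_add, dotProduct_smul, dotProduct_smul, smul_eq_mul, smul_eq_mul]
    have h2 : K = (1 - t) * (p ⬝ᵥ a) + t * (v ⬝ᵥ a) * u := by
      rw [hu, hsymm v p, hK]
      conv_lhs => rw [hGp]
      rw [dotProduct_add, dotProduct_smul, dotProduct_smul, smul_eq_mul, smul_eq_mul]
    have h3 : (v ⬝ᵥ a) * u ≤ K := by
      have : (1 - t) * K ≤ (1 - t) * (p ⬝ᵥ a) :=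
        mul_le_mul_of_nonneg_left hle (sub_pos.2 ht1).le
      exact le_of_mul_le_mul_left (by linarith) ht0
    have h4 : 0 ≤ 1 - t + t * h := by
      have := mul_nonneg ht0.le hh0
      linarith
    calc u ^ 2 = (v ⬝ᵥ a) * u * (1 - t + t * h) := by rw [sq]; nth_rewrite 1 [h1]; ring
      _ ≤ _ := mul_le_mul_of_nonneg_right h3 h4
  have hlim : Filter.Tendsto (fun t : ℝ => K * (1 - t + t * h)) (nhdsWithin 0 (Set.Ioi 0))
      (nhds K) := by
    have : Continuous fun t : ℝ => K * (1 - t + t * h) := by fun_prop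
    simpa using (this.tendsto 0).mono_left nhdsWithin_le_nhds
  refine ge_of_tendsto hlim ?_
  filter_upwards [Ioo_mem_nhdsGT (zero_lt_one (α := ℝ))] with t ht
  exact key t ht.1 ht.2

end WeightedGram

/-- **Theorem 3.2, first direction: optimal weights come from an ℓ¹ minimizer.**
Let `V ∈ ℝ^{M×N}` (`M ≥ N`) have full rank `N` and `p ∈ ℝ^N` nonzero.  If the
probability weight vector `w*` minimizes `K w = pᵗ (Vᵗ (diag w) V)⁻¹ p` over all
probability weight vectors with invertible Gram matrix, and `G(w*)` is invertible,
then there exists `c ∈ ℝ^M` with `Vᵗ c = p`, `‖c‖₁ = √(K w*)`,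
`w*ᵢ = |cᵢ|/‖c‖₁` for all `i`, and `c` minimizes the ℓ¹ norm over `{c' : Vᵗ c' = p}`. -/
theorem optimal_weights_from_l1_minimizer (M N : ℕ) (hMN : N ≤ M)
    (V : Matrix (Fin M) (Fin N) ℝ) (hV : V.rank = N)
    (p : Fin N → ℝ) (hp : p ≠ 0)
    (wstar : Fin M → ℝ) (hw0 : ∀ i, 0 ≤ wstar i) (hw1 : (∑ i, wstar i) = 1)
    (hG : IsUnit (Vᵀ * Matrix.diagonal wstar * V))
    (hmin : ∀ w : Fin M → ℝ, (∀ i, 0 ≤ w i) → (∑ i, w i) = 1 →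
      IsUnit (Vᵀ * Matrix.diagonal w * V) →
      p ⬝ᵥ ((Vᵀ * Matrix.diagonal wstar * V)⁻¹ *ᵥ p) ≤
        p ⬝ᵥ ((Vᵀ * Matrix.diagonal w * V)⁻¹ *ᵥ p)) :
    ∃ c : Fin M → ℝ,
      Vᵀ *ᵥ c = p ∧
      (∑ i, |c i|) = Real.sqrt (p ⬝ᵥ ((Vᵀ * Matrix.diagonal wstar * V)⁻¹ *ᵥ p)) ∧
      (∀ i, wstar i = |c i| / ∑ j, |c j|) ∧
      (∀ c' : Fin M → ℝ, Vᵀ *ᵥ c' = p → (∑ i, |c i|) ≤ ∑ i, |c' i|) := by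
  set G := Vᵀ * Matrix.diagonal wstar * V with hGdef
  have hpd : G.PosDef := (weightedGram_posSemidef V hw0).posDef_iff_isUnit.2 hG
  set K := p ⬝ᵥ (G⁻¹ *ᵥ p) with hK
  set u := V *ᵥ (G⁻¹ *ᵥ p) with hu
  have hKpos : 0 < K := by simpa using hpd.inv.dotProduct_mulVec_pos hp
  have hsqrt : 0 < √K := Real.sqrt_pos.2 hKpos
  have hfeas : Vᵀ *ᵥ (fun i => wstar i * u i) = p := by
    rw [hu, ← weightedGram_mulVec, ← hGdef, mulVec_mulVec,
      mul_nonsing_inv _ ((isUnit_iff_isUnit_det _).1 hG), one_mulVec]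
  have hdual : ∀ c : Fin M → ℝ, Vᵀ *ᵥ c = p → K = ∑ i, c i * u i := by
    intro c hc
    rw [hK]
    nth_rewrite 1 [← hc]
    rw [mulVec_transpose, ← dotProduct_mulVec]
    rfl
  have hu_sq : ∀ i, u i ^ 2 ≤ K := by
    intro i
    refine hpd.sq_dotProduct_inv_mulVec_le p (V i) fun t ht0 ht1 => ?_
    have hmix := weightedGram_mix V wstar i t
    rw [← hGdef] at hmix
    rw [← hmix]
    refine hmin _ (fun j => ?_) ?_ ?_
    · have h1 : 0 ≤ (Pi.single i 1 : Fin M → ℝ) j := by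
        rw [Pi.single_apply]; split_ifs <;> norm_num
      exact add_nonneg (mul_nonneg (sub_pos.2 ht1).le (hw0 j)) (mul_nonneg ht0.le h1)
    · simp [Finset.sum_add_distrib, ← Finset.mul_sum, hw1]
    · have hvv : (vecMulVec (V i) (V i)).PosSemidef := by
        simpa using posSemidef_vecMulVec_self_star (V i)
      rw [hmix]
      exact ((hpd.smul (sub_pos.2 ht1)).add_posSemidef (hvv.smul ht0.le)).isUnit
  have hu_abs : ∀ i, |u i| ≤ √K := fun i => Real.abs_le_sqrt (hu_sq i)
  have hc_abs : ∀ i, |wstar i * u i| = wstar i * √K := by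
    have hsum : ∑ i, wstar i * (K - u i ^ 2) = 0 := by
      have h := hdual _ hfeas
      simp only [mul_sub, Finset.sum_sub_distrib, ← Finset.sum_mul, hw1, one_mul]
      rw [sub_eq_zero, h]
      exact Finset.sum_congr rfl fun i _ => by ring
    intro i
    have hi := (Finset.sum_eq_zero_iff_of_nonneg fun i _ =>
      mul_nonneg (hw0 i) (sub_nonneg.2 (hu_sq i))).1 hsum i (Finset.mem_univ i)
    rw [abs_mul, abs_of_nonneg (hw0 i)]
    rcases mul_eq_zero.1 hi with h | h
    · simp [h]
    · rw [sub_eq_zero.1 h, Real.sqrt_sq_eq_abs]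
  have hnorm : ∑ i, |wstar i * u i| = √K := by
    simp only [hc_abs, ← Finset.sum_mul, hw1, one_mul]
  refine ⟨fun i => wstar i * u i, hfeas, hnorm, fun i => ?_, fun c' hc' => ?_⟩
  · rw [hnorm, hc_abs, mul_div_cancel_right₀ _ hsqrt.ne']
  · rw [hnorm]
    refine le_of_mul_le_mul_right ?_ hsqrt
    calc √K * √K = ∑ i, c' i * u i := by rw [Real.mul_self_sqrt hKpos.le, hdual c' hc']
      _ ≤ ∑ i, |c' i| * √K := Finset.sum_le_sum fun i _ =>
          (le_abs_self _).trans <| by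
            rw [abs_mul]; exact mul_le_mul_of_nonneg_left (hu_abs i) (abs_nonneg _)
      _ = _ := by rw [Finset.sum_mul]
end

section
/- Let V ∈ ℝ^{M×N} (M ≥ N) have full rank N and let p ∈ ℝ^N be nonzero. Suppose c ∈ ℝ^M minimizes ‖c‖₁ subject to V^t c = p, and set w := |c| / ‖c‖₁ (so w_i = |c_i|/‖c‖₁). If the Gram matrix G(w) = V^t diag(w) V is invertible, then K(w) = p^t G(w)^{-1} p = ‖c‖₁², and w minimizes K over all probability weight vectors w' ∈ ℝ^M for which G(w') is invertible; that is, the discrete probability measure with weights w_i at the points x_i is an optimal prediction measure of degree n. -/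
open Matrix

/-- If the weighted Gram matrix `Vᵀ (diag w) V` is invertible, the values `y = V (G(w)⁻¹ p)` of the
representing function satisfy `Vᵀ (w y) = p`, and `pᵗ G(w)⁻¹ p = c ⬝ᵥ y` for every `c` with
`Vᵀ c = p`. -/
lemma exists_representer_of_isUnit_gram {m n : Type*} [Fintype m] [Fintype n]
    [DecidableEq m] [DecidableEq n] (V : Matrix m n ℝ) (p : n → ℝ) (w : m → ℝ)
    (hG : IsUnit (Vᵀ * diagonal w * V)) :
    ∃ y : m → ℝ, Vᵀ *ᵥ (fun i => w i * y i) = p ∧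
      ∀ c : m → ℝ, Vᵀ *ᵥ c = p →
        p ⬝ᵥ ((Vᵀ * diagonal w * V)⁻¹ *ᵥ p) = ∑ i, c i * y i := by
  refine ⟨V *ᵥ ((Vᵀ * diagonal w * V)⁻¹ *ᵥ p), ?_, fun c hc => ?_⟩
  · have hdiag : (fun i => w i * (V *ᵥ ((Vᵀ * diagonal w * V)⁻¹ *ᵥ p)) i) =
        diagonal w *ᵥ (V *ᵥ ((Vᵀ * diagonal w * V)⁻¹ *ᵥ p)) := by
      ext i
      rw [mulVec_diagonal]
    rw [hdiag, mulVec_mulVec, mulVec_mulVec, mulVec_mulVec,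
      mul_nonsing_inv _ ((isUnit_iff_isUnit_det _).mp hG), one_mulVec]
  · rw [mulVec_transpose] at hc
    change _ = c ⬝ᵥ _
    rw [dotProduct_mulVec c, hc]

/-- Jensen's inequality for squares of absolute values with probability weights. -/
lemma sq_sum_mul_abs_le_sum_mul_sq {m : Type*} [Fintype m] (w y : m → ℝ) (hw : ∀ i, 0 ≤ w i)
    (hsum : ∑ i, w i = 1) : (∑ i, w i * |y i|) ^ 2 ≤ ∑ i, w i * y i ^ 2 := by
  simpa using Real.pow_arith_mean_le_arith_mean_pow Finset.univ w (fun i => |y i|)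
    (fun i _ => hw i) hsum (fun i _ => abs_nonneg _) 2

/-- **Theorem 3.2, converse direction: ℓ¹ minimizers give optimal weights.**
Let `V ∈ ℝ^{M×N}` (`M ≥ N`) have full rank `N` and `p ∈ ℝ^N` nonzero.  If `c`
minimizes `‖c‖₁` subject to `Vᵗ c = p` and `w = |c|/‖c‖₁`, then, provided
`G(w) = Vᵗ (diag w) V` is invertible, `K w = pᵗ G(w)⁻¹ p = ‖c‖₁²` and `w` minimizes
`K` over all probability weight vectors with invertible Gram matrix; i.e. the discrete
probability measure with weights `w` is an optimal prediction measure of degree `n`. -/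
theorem l1_minimizer_gives_optimal_weights (M N : ℕ) (hMN : N ≤ M)
    (V : Matrix (Fin M) (Fin N) ℝ) (hV : V.rank = N)
    (p : Fin N → ℝ) (hp : p ≠ 0)
    (c : Fin M → ℝ) (hc : Vᵀ *ᵥ c = p)
    (hcmin : ∀ c' : Fin M → ℝ, Vᵀ *ᵥ c' = p → (∑ i, |c i|) ≤ ∑ i, |c' i|)
    (w : Fin M → ℝ) (hw : w = fun i => |c i| / ∑ j, |c j|)
    (hG : IsUnit (Vᵀ * Matrix.diagonal w * V)) :
    p ⬝ᵥ ((Vᵀ * Matrix.diagonal w * V)⁻¹ *ᵥ p) = (∑ i, |c i|) ^ 2 ∧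
    ∀ w' : Fin M → ℝ, (∀ i, 0 ≤ w' i) → (∑ i, w' i) = 1 →
      IsUnit (Vᵀ * Matrix.diagonal w' * V) →
      p ⬝ᵥ ((Vᵀ * Matrix.diagonal w * V)⁻¹ *ᵥ p) ≤
        p ⬝ᵥ ((Vᵀ * Matrix.diagonal w' * V)⁻¹ *ᵥ p) := by
  have hS : 0 < ∑ i, |c i| := by
    refine (Finset.sum_nonneg fun i _ => abs_nonneg _).lt_of_ne' fun h => hp ?_
    have hc0 : c = 0 := by
      ext i
      simpa using (Finset.sum_eq_zero_iff_of_nonneg fun i _ => abs_nonneg (c i)).mp h i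
    rw [← hc, hc0, mulVec_zero]
  have hw0 : ∀ i, 0 ≤ w i := fun i => by
    rw [hw]
    positivity
  have hw1 : ∑ i, w i = 1 := by
    rw [hw, ← Finset.sum_div, div_self hS.ne']
  have lower : ∀ w' : Fin M → ℝ, (∀ i, 0 ≤ w' i) → (∑ i, w' i) = 1 →
      IsUnit (Vᵀ * Matrix.diagonal w' * V) →
      (∑ i, |c i|) ^ 2 ≤ p ⬝ᵥ ((Vᵀ * Matrix.diagonal w' * V)⁻¹ *ᵥ p) := by
    intro w' h0 h1 hG'
    obtain ⟨y, hy, hK⟩ := exists_representer_of_isUnit_gram V p w' hG'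
    calc (∑ i, |c i|) ^ 2 ≤ (∑ i, w' i * |y i|) ^ 2 := by
          refine pow_le_pow_left₀ hS.le ?_ 2
          simpa [abs_mul, abs_of_nonneg (h0 _)] using hcmin _ hy
      _ ≤ ∑ i, w' i * y i ^ 2 := sq_sum_mul_abs_le_sum_mul_sq w' y h0 h1
      _ = p ⬝ᵥ ((Vᵀ * Matrix.diagonal w' * V)⁻¹ *ᵥ p) := by
          rw [hK _ hy]
          exact Finset.sum_congr rfl fun i _ => by ring
  have upper : p ⬝ᵥ ((Vᵀ * Matrix.diagonal w * V)⁻¹ *ᵥ p) ≤ (∑ i, |c i|) ^ 2 := by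
    obtain ⟨y, hy, hK⟩ := exists_representer_of_isUnit_gram V p w hG
    have hjensen : (∑ i, w i * |y i|) ^ 2 ≤ p ⬝ᵥ ((Vᵀ * Matrix.diagonal w * V)⁻¹ *ᵥ p) := by
      refine (sq_sum_mul_abs_le_sum_mul_sq w y hw0 hw1).trans_eq ?_
      rw [hK _ hy]
      exact Finset.sum_congr rfl fun i _ => by ring
    have hholder : p ⬝ᵥ ((Vᵀ * Matrix.diagonal w * V)⁻¹ *ᵥ p) ≤
        (∑ i, |c i|) * ∑ i, w i * |y i| := by
      rw [hK c hc, Finset.mul_sum]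
      refine Finset.sum_le_sum fun i _ => (le_abs_self _).trans_eq ?_
      rw [abs_mul, hw]
      field_simp
    have hT : 0 ≤ ∑ i, w i * |y i| :=
      Finset.sum_nonneg fun i _ => mul_nonneg (hw0 i) (abs_nonneg _)
    nlinarith [sq_nonneg ((∑ i, |c i|) - ∑ i, w i * |y i|)]
  have hK := upper.antisymm (lower w hw0 hw1 hG)
  exact ⟨hK, fun w' h0 h1 hG' => hK.trans_le (lower w' h0 h1 hG')⟩
end

section
/- Let A ∈ ℝ^{N×M} and b ∈ ℝ^N, and suppose the set {c ∈ ℝ^M : Ac = b} is nonempty. Then the minimum of ‖c‖₁ over {c : Ac = b} is attained and equals the supremum of z^t b over {z ∈ ℝ^N : ‖A^t z‖_∞ ≤ 1}, where ‖·‖₁ is the sum of absolute values of the entries and ‖·‖_∞ is the maximum absolute value of the entries. -/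
open Matrix

/-- If `c` has minimal norm in its fibre under a linear map `T`, then some linear functional `φ` on
the codomain satisfies `|φ (T x)| ≤ ‖x‖` for all `x`, with `φ (T c) = ‖c‖`. -/
theorem LinearMap.exists_dual_comp_le_norm_of_forall_norm_le {E F : Type*}
    [SeminormedAddCommGroup E] [NormedSpace ℝ E] [AddCommGroup F] [Module ℝ F] (T : E →ₗ[ℝ] F)
    (c : E) (hc : ∀ x, T x = T c → ‖c‖ ≤ ‖x‖) :
    ∃ φ : Module.Dual ℝ F, (∀ x, |φ (T x)| ≤ ‖x‖) ∧ φ (T c) = ‖c‖ := by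
  obtain ⟨g, hg, hgc⟩ := exists_dual_vector'' ℝ (Submodule.Quotient.mk c : E ⧸ T.ker)
  have hnorm : ‖(Submodule.Quotient.mk c : E ⧸ T.ker)‖ = ‖c‖ := by
    refine le_antisymm (Submodule.Quotient.norm_mk_le _ c)
      (QuotientAddGroup.le_norm_iff.2 fun x hx => hc x ?_)
    have hmem : x - c ∈ T.ker := (Submodule.Quotient.eq _).1 hx
    rwa [LinearMap.mem_ker, map_sub, sub_eq_zero] at hmem
  have hmem : g.toLinearMap ∘ₗ T.ker.mkQ ∈ LinearMap.range T.dualMap := by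
    rw [LinearMap.range_dualMap_eq_dualAnnihilator_ker, Submodule.mem_dualAnnihilator]
    intro w hw
    simp [(Submodule.Quotient.mk_eq_zero _).2 hw]
  obtain ⟨φ, hφ⟩ := hmem
  have hφ' (x : E) : φ (T x) = g (Submodule.Quotient.mk x) := LinearMap.congr_fun hφ x
  refine ⟨φ, fun x => ?_, ?_⟩
  · rw [hφ', ← Real.norm_eq_abs]
    exact (g.le_of_opNorm_le hg _).trans (by simpa using Submodule.Quotient.norm_mk_le _ x)
  · rw [hφ', hgc, hnorm]
    rfl

/-- Hölder's inequality for the `ℓ^∞` and `ℓ¹` norms. -/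
theorem dotProduct_le_sum_abs {ι : Type*} [Fintype ι] {y : ι → ℝ} (hy : ∀ i, |y i| ≤ 1)
    (x : ι → ℝ) : y ⬝ᵥ x ≤ ∑ i, |x i| := by
  refine Finset.sum_le_sum fun i _ => (le_abs_self _).trans ?_
  rw [abs_mul]
  exact mul_le_of_le_one_left (abs_nonneg _) (hy i)

/-- **ℓ¹ minimization duality (Proposition, strong duality part).**
Let `A ∈ ℝ^{N×M}` and `b ∈ ℝ^N` with `{c : A c = b}` nonempty.  Then the minimum of
`‖c‖₁` over `{c : A c = b}` is attained and equals the supremum of `zᵗ b` over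
`{z : ‖Aᵗ z‖_∞ ≤ 1}`. -/
theorem l1_duality (N M : ℕ)
    (A : Matrix (Fin N) (Fin M) ℝ) (b : Fin N → ℝ)
    (hfeas : ∃ c : Fin M → ℝ, A *ᵥ c = b) :
    ∃ c : Fin M → ℝ, A *ᵥ c = b ∧
      (∀ c' : Fin M → ℝ, A *ᵥ c' = b → (∑ i, |c i|) ≤ ∑ i, |c' i|) ∧
      IsLUB {v : ℝ | ∃ z : Fin N → ℝ, (∀ j, |(Aᵀ *ᵥ z) j| ≤ 1) ∧ v = z ⬝ᵥ b}
        (∑ i, |c i|) := by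
  let T : PiLp 1 (fun _ : Fin M => ℝ) →ₗ[ℝ] (Fin N → ℝ) :=
    A.mulVecLin ∘ₗ (WithLp.linearEquiv 1 ℝ (Fin M → ℝ)).toLinearMap
  have hT (x : PiLp 1 fun _ : Fin M => ℝ) : T x = A *ᵥ x.ofLp := rfl
  obtain ⟨c₀, hc₀⟩ := hfeas
  have hclosed : IsClosed {x | T x = b} :=
    isClosed_eq T.continuous_of_finiteDimensional continuous_const
  obtain ⟨c, hc, hdist⟩ := hclosed.exists_infDist_eq_dist ⟨WithLp.toLp 1 c₀, hc₀⟩ 0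
  have hmin (x : PiLp 1 fun _ : Fin M => ℝ) (hx : T x = b) : ‖c‖ ≤ ‖x‖ := by
    rw [← dist_zero_left c, ← hdist, ← dist_zero_left x]
    exact Metric.infDist_le_dist_of_mem hx
  have hTc : T c = b := hc
  have hnorm (x : PiLp 1 fun _ : Fin M => ℝ) : ‖x‖ = ∑ i, |x.ofLp i| := PiLp.norm_eq_of_L1 x
  obtain ⟨φ, hφ, hφc⟩ :=
    T.exists_dual_comp_le_norm_of_forall_norm_le c fun x hx => hmin x (hx.trans hTc)
  obtain ⟨z, rfl⟩ := (dotProductEquiv ℝ (Fin N)).surjective φ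
  refine ⟨c.ofLp, hTc, fun c' hc' => ?_, ?_, fun u hu => hu ⟨z, fun j => ?_, ?_⟩⟩
  · simpa only [hnorm] using hmin (WithLp.toLp 1 c') hc'
  · rintro _ ⟨y, hy, rfl⟩
    rw [← hTc, hT, dotProduct_mulVec, ← mulVec_transpose]
    exact dotProduct_le_sum_abs hy _
  · have h := hφ (PiLp.single 1 j 1)
    rw [PiLp.norm_single, norm_one, dotProductEquiv_apply_apply, hT, dotProduct_mulVec,
      ← mulVec_transpose] at h
    simpa using h
  · rw [← hnorm, ← hφc, hTc, dotProductEquiv_apply_apply]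
end

section
/- Let X = {x_1, ..., x_M} ⊂ ℝ^d, let P_1, ..., P_N be a basis of the real polynomials of total degree at most n, let V ∈ ℝ^{M×N} be the Vandermonde matrix V_{ij} = P_j(x_i), assumed of full rank N, and let z_0 ∈ ℝ^d with p_i = P_i(z_0). Then the minimum of ‖c‖₁ over {c ∈ ℝ^M : V^t c = p} equals the maximum of |P(z_0)| over all polynomials P of total degree at most n satisfying max_{x ∈ X} |P(x)| ≤ 1. -/
open Matrix MvPolynomial

/-- A linear form on a finite-dimensional normed space attains its operator norm on the closed
unit ball. -/
theorem exists_norm_le_one_norm_eq_opNorm {E : Type*} [NormedAddCommGroup E] [NormedSpace ℝ E]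
    [FiniteDimensional ℝ E] (f : E →L[ℝ] ℝ) : ∃ u : E, ‖u‖ ≤ 1 ∧ ‖f‖ ≤ ‖f u‖ := by
  have : ProperSpace E := FiniteDimensional.proper ℝ E
  obtain ⟨u, hu, hmax⟩ := (isCompact_closedBall (0 : E) 1).exists_isMaxOn
    ⟨0, by simp⟩ (f.continuous.norm.continuousOn)
  refine ⟨u, by simpa using hu, ?_⟩
  refine f.opNorm_le_of_unit_norm (norm_nonneg _) fun y hy => ?_
  exact hmax (by simp [hy])

/-- The `ℓ¹` norm of the coefficients of a linear form on `ℝᵐ` with the sup norm is at most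
its operator norm. -/
theorem sum_abs_apply_single_le_opNorm {m : Type*} [Fintype m] [DecidableEq m]
    (g : (m → ℝ) →L[ℝ] ℝ) : ∑ i, |g (Pi.single i 1)| ≤ ‖g‖ := by
  let s : m → ℝ := fun i => SignType.sign (g (Pi.single i 1))
  have hs : ‖s‖ ≤ 1 := by
    refine (pi_norm_le_iff_of_nonneg zero_le_one).2 fun i => ?_
    dsimp only [s]
    cases SignType.sign (g (Pi.single i 1)) <;> simp
  have hgs : g s = ∑ i, |g (Pi.single i 1)| := by
    rw [← ContinuousLinearMap.coe_coe, LinearMap.pi_apply_eq_sum_univ]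
    refine Finset.sum_congr rfl fun i _ => ?_
    have : (fun j => if i = j then (1 : ℝ) else 0) = Pi.single i 1 := by
      ext j; simp [Pi.single_apply, eq_comm]
    simp [this, s, sign_mul_self]
  calc ∑ i, |g (Pi.single i 1)| = g s := hgs.symm
    _ ≤ ‖g s‖ := le_abs_self _
    _ ≤ ‖g‖ * ‖s‖ := g.le_opNorm s
    _ ≤ ‖g‖ := mul_le_of_le_one_right (norm_nonneg _) hs

/-- Strong duality between `ℓ¹` minimisation under `Aᵀ c = p` and maximisation of `p ⬝ a` under
the sup norm constraint on `A a`. -/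
theorem exists_transpose_mulVec_eq_and_sum_abs_le {m n : Type*} [Fintype m] [Fintype n]
    (A : Matrix m n ℝ) (hA : Function.Injective A.mulVec) (p : n → ℝ) :
    ∃ (c : m → ℝ) (a : n → ℝ), Aᵀ *ᵥ c = p ∧ (∀ i, |(A *ᵥ a) i| ≤ 1) ∧
      ∑ i, |c i| ≤ |p ⬝ᵥ a| := by
  classical
  obtain ⟨L, hL⟩ := A.mulVecLin.exists_leftInverse_of_injective
    (LinearMap.ker_eq_bot.2 hA)
  have hLA : ∀ a, L (A *ᵥ a) = a := fun a => by simpa using LinearMap.congr_fun hL a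
  let S := LinearMap.range A.mulVecLin
  let f : S →L[ℝ] ℝ := LinearMap.toContinuousLinearMap
    ((dotProductBilin ℝ ℝ p ∘ₗ L).domRestrict S)
  have hf : ∀ a (h : A *ᵥ a ∈ S), f ⟨A *ᵥ a, h⟩ = p ⬝ᵥ a := fun a h => by
    simp [f, hLA]
  obtain ⟨g, hg, hgn⟩ := exists_extension_norm_eq S f
  obtain ⟨⟨_, a, rfl⟩, hu, hfu⟩ := exists_norm_le_one_norm_eq_opNorm f
  refine ⟨fun i => g (Pi.single i 1), a, ?_, ?_, ?_⟩
  · ext j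
    have hj := (hg ⟨A *ᵥ Pi.single j 1, ⟨_, rfl⟩⟩).trans (hf (Pi.single j 1) _)
    rw [dotProduct_single_one, ← ContinuousLinearMap.coe_coe,
      LinearMap.pi_apply_eq_sum_univ] at hj
    rw [← hj]
    simp only [mulVec, dotProduct, transpose_apply]
    refine Finset.sum_congr rfl fun i _ => ?_
    have : (fun j => if i = j then (1 : ℝ) else 0) = Pi.single i 1 := by
      ext j; simp [Pi.single_apply, eq_comm]
    simp [this, Pi.single_apply]
  · exact fun i => (norm_le_pi_norm (A *ᵥ a) i).trans hu
  · calc ∑ i, |g (Pi.single i 1)| ≤ ‖g‖ := sum_abs_apply_single_le_opNorm g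
      _ = ‖f‖ := hgn
      _ ≤ _ := hfu
      _ = |p ⬝ᵥ a| := by rw [Real.norm_eq_abs]; exact congrArg _ (hf a _)

/-- Weak duality between the `ℓ¹` norm and the sup norm. -/
theorem abs_dotProduct_le_sum_abs {m : Type*} [Fintype m] (c w : m → ℝ)
    (hw : ∀ i, |w i| ≤ 1) : |c ⬝ᵥ w| ≤ ∑ i, |c i| :=
  (Finset.abs_sum_le_sum_abs _ _).trans <| Finset.sum_le_sum fun i _ => by
    rw [abs_mul]
    exact mul_le_of_le_one_right (abs_nonneg _) (hw i)

/-- **ℓ¹ minimum equals maximal polynomial growth.**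
For points `X = {x 1, …, x M} ⊂ ℝᵈ`, a basis `P 1, …, P N` of the real polynomials of
total degree at most `n`, the (full rank) Vandermonde matrix `V i j = P j (x i)` and
`p i = P i (z₀)`:  the minimum of `‖c‖₁` over `{c : Vᵗ c = p}` equals the maximum of
`|P(z₀)|` over polynomials `P` of total degree at most `n` with `max_{x ∈ X} |P(x)| ≤ 1`. -/
theorem l1_min_eq_max_growth (d n M N : ℕ)
    (x : Fin M → (Fin d → ℝ))
    (P : Fin N → MvPolynomial (Fin d) ℝ)
    (hPdeg : ∀ j, (P j).totalDegree ≤ n)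
    (hPind : LinearIndependent ℝ P)
    (hPspan : ∀ q : MvPolynomial (Fin d) ℝ, q.totalDegree ≤ n →
      q ∈ Submodule.span ℝ (Set.range P))
    (V : Matrix (Fin M) (Fin N) ℝ)
    (hVdef : ∀ i j, V i j = MvPolynomial.eval (x i) (P j))
    (hV : V.rank = N)
    (z0 : Fin d → ℝ)
    (p : Fin N → ℝ) (hp : ∀ i, p i = MvPolynomial.eval z0 (P i)) :
    ∃ v : ℝ,
      IsLeast {t : ℝ | ∃ c : Fin M → ℝ, Vᵀ *ᵥ c = p ∧ t = ∑ i, |c i|} v ∧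
      IsGreatest {t : ℝ | ∃ q : MvPolynomial (Fin d) ℝ, q.totalDegree ≤ n ∧
        (∀ i, |MvPolynomial.eval (x i) q| ≤ 1) ∧ t = |MvPolynomial.eval z0 q|} v := by
  have hinj : Function.Injective V.mulVec := by
    rw [mulVec_injective_iff, linearIndependent_iff_card_eq_finrank_span, Set.finrank,
      ← rank_eq_finrank_span_cols, hV, Fintype.card_fin]
  have heval : ∀ (y : Fin d → ℝ) (a : Fin N → ℝ),
      eval y (∑ j, a j • P j) = (fun j => eval y (P j)) ⬝ᵥ a := fun y a => by
    simp [dotProduct, smul_eval, mul_comm]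
  have hz : ∀ a : Fin N → ℝ, eval z0 (∑ j, a j • P j) = p ⬝ᵥ a := fun a => by
    rw [heval, ← funext hp]
  have hx : ∀ (a : Fin N → ℝ) i, eval (x i) (∑ j, a j • P j) = (V *ᵥ a) i := fun a i => by
    rw [heval, ← funext (hVdef i)]; rfl
  have hweak : ∀ (c : Fin M → ℝ) (q : MvPolynomial (Fin d) ℝ), Vᵀ *ᵥ c = p →
      q.totalDegree ≤ n → (∀ i, |eval (x i) q| ≤ 1) → |eval z0 q| ≤ ∑ i, |c i| := by
    intro c q hc hq hq1
    obtain ⟨a, rfl⟩ := (Submodule.mem_span_range_iff_exists_fun ℝ).1 (hPspan q hq)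
    simp only [hx] at hq1
    rw [hz, ← hc, mulVec_transpose, ← dotProduct_mulVec]
    exact abs_dotProduct_le_sum_abs c _ hq1
  obtain ⟨c, a, hc, ha, hca⟩ := exists_transpose_mulVec_eq_and_sum_abs_le V hinj p
  have hdeg : (∑ j, a j • P j).totalDegree ≤ n :=
    totalDegree_finsetSum_le fun j _ => (totalDegree_smul_le _ _).trans (hPdeg j)
  have hbd : ∀ i, |eval (x i) (∑ j, a j • P j)| ≤ 1 := fun i => by rw [hx]; exact ha i
  have heq : ∑ i, |c i| = |eval z0 (∑ j, a j • P j)| :=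
    le_antisymm (by rwa [hz]) (hweak c _ hc hdeg hbd)
  refine ⟨∑ i, |c i|, ⟨⟨c, hc, rfl⟩, ?_⟩, ⟨⟨_, hdeg, hbd, heq⟩, ?_⟩⟩
  · rintro _ ⟨c', hc', rfl⟩
    exact heq.trans_le (hweak c' _ hc' hdeg hbd)
  · rintro _ ⟨q, hq, hq1, rfl⟩
    exact hweak c q hc hq hq1
end

section
/- Let A ⊂ ℝ^d be compact, z_0 ∈ ℝ^d \ A, and n ≥ 1. For a probability Borel measure μ on A define Λ_n(μ) := sup { p(z_0)² : p a real polynomial in d variables of total degree at most n with ∫_A p² dμ ≤ 1 }. Suppose ν* minimizes the total variation |ν|(A) among all finite signed Borel measures ν supported in A satisfying ∫_A p dν = p(z_0) for every polynomial p of total degree ≤ n, where the support of the competing measures is required to contain the support of some measure minimizing Λ_n. Then the probability measure μ_n := |ν*| / |ν*|(A) minimizes Λ_n among probability measures on A, and Λ_n(μ_n) = (|ν*|(A))². -/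
open MeasureTheory MvPolynomial ENNReal

/-- The prediction variance `Λ_n(μ) = sup { p(z₀)² : deg p ≤ n, ∫ p² dμ ≤ 1 }`
(the reciprocal Christoffel function at `z₀`), valued in `ℝ≥0∞`. -/
noncomputable def predVar (d n : ℕ) (z0 : Fin d → ℝ)
    (μ : MeasureTheory.Measure (Fin d → ℝ)) : ℝ≥0∞ :=
  sSup {t : ℝ≥0∞ | ∃ p : MvPolynomial (Fin d) ℝ, p.totalDegree ≤ n ∧
    (∫ x, (MvPolynomial.eval x p) ^ 2 ∂μ) ≤ 1 ∧
    t = ENNReal.ofReal ((MvPolynomial.eval z0 p) ^ 2)}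

/-- The (closed topological) support of a measure. -/
def measSupport {X : Type*} [TopologicalSpace X] [MeasurableSpace X]
    (μ : MeasureTheory.Measure X) : Set X :=
  {x | ∀ U ∈ nhds x, μ U ≠ 0}

namespace MeasureTheory.SignedMeasure

variable {α : Type*} [MeasurableSpace α]

theorem posPart_add_eq_negPart_add {s : SignedMeasure α} {μ ν : Measure α}
    [IsFiniteMeasure μ] [IsFiniteMeasure ν] (h : s = μ.toSignedMeasure - ν.toSignedMeasure) :
    s.toJordanDecomposition.posPart + ν = s.toJordanDecomposition.negPart + μ := by
  have h2 := s.toSignedMeasure_toJordanDecomposition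
  rw [JordanDecomposition.toSignedMeasure] at h2
  rw [← Measure.toSignedMeasure_eq_toSignedMeasure_iff, Measure.toSignedMeasure_add,
    Measure.toSignedMeasure_add, add_comm s.toJordanDecomposition.negPart.toSignedMeasure,
    ← sub_eq_sub_iff_add_eq_add, h2, h]

theorem totalVariation_le {s : SignedMeasure α} {μ ν : Measure α}
    [IsFiniteMeasure μ] [IsFiniteMeasure ν] (h : s = μ.toSignedMeasure - ν.toSignedMeasure) :
    s.totalVariation ≤ μ + ν := by
  have heq := posPart_add_eq_negPart_add h
  obtain ⟨S, hS, hpos, hneg⟩ := s.toJordanDecomposition.mutuallySingular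
  refine add_le_add (Measure.le_iff.2 fun B _ => ?_) (Measure.le_iff.2 fun B _ => ?_)
  · have hE := congrArg (fun m : Measure α => m (B \ S)) heq
    simp only [Measure.add_apply] at hE
    rw [measure_mono_null (fun x hx => hx.2) hneg, zero_add] at hE
    calc s.toJordanDecomposition.posPart B
        = s.toJordanDecomposition.posPart (B \ S) := (measure_sdiff_null hpos).symm
      _ ≤ μ (B \ S) := hE ▸ le_self_add
      _ ≤ μ B := measure_mono Set.sdiff_subset
  · have hE := congrArg (fun m : Measure α => m (B \ Sᶜ)) heq
    simp only [Measure.add_apply] at hE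
    rw [measure_mono_null (fun x hx => not_not.1 hx.2) hpos, zero_add] at hE
    calc s.toJordanDecomposition.negPart B
        = s.toJordanDecomposition.negPart (B \ Sᶜ) := (measure_sdiff_null hneg).symm
      _ ≤ ν (B \ Sᶜ) := hE ▸ le_self_add
      _ ≤ ν B := measure_mono Set.sdiff_subset

theorem integral_posPart_sub_integral_negPart {s : SignedMeasure α} {μ ν : Measure α}
    [IsFiniteMeasure μ] [IsFiniteMeasure ν] (h : s = μ.toSignedMeasure - ν.toSignedMeasure)
    {f : α → ℝ} (hμ : Integrable f μ) (hν : Integrable f ν) :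
    (∫ x, f x ∂s.toJordanDecomposition.posPart) - (∫ x, f x ∂s.toJordanDecomposition.negPart)
      = (∫ x, f x ∂μ) - ∫ x, f x ∂ν := by
  have hs : Integrable f s.totalVariation := (hμ.add_measure hν).mono_measure (totalVariation_le h)
  have hp : Integrable f s.toJordanDecomposition.posPart := hs.left_of_add_measure
  have hn : Integrable f s.toJordanDecomposition.negPart := hs.right_of_add_measure
  have hE := congrArg (fun m : Measure α => ∫ x, f x ∂m) (posPart_add_eq_negPart_add h)
  simp only [integral_add_measure hp hν, integral_add_measure hn hμ] at hE
  linarith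

theorem totalVariation_eq_zero_of_forall {s : SignedMeasure α} {U : Set α} (hU : MeasurableSet U)
    (h : ∀ B, MeasurableSet B → B ⊆ U → s B = 0) : s.totalVariation U = 0 := by
  obtain ⟨S, hS, hpos, hneg⟩ := s.toJordanDecomposition.mutuallySingular
  rw [totalVariation, Measure.add_apply, add_eq_zero]
  constructor
  · have h1 := h (U \ S) (hU.diff hS) Set.sdiff_subset
    rw [apply_eq_posPart_real_sub_negPart_real _ (hU.diff hS),
      measureReal_def (μ := s.toJordanDecomposition.negPart),
      measure_mono_null (fun x hx => hx.2) hneg, ENNReal.toReal_zero, sub_zero,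
      measureReal_eq_zero_iff] at h1
    rw [← measure_sdiff_null hpos, h1]
  · have h1 := h (U \ Sᶜ) (hU.diff hS.compl) Set.sdiff_subset
    rw [apply_eq_posPart_real_sub_negPart_real _ (hU.diff hS.compl),
      measureReal_def (μ := s.toJordanDecomposition.posPart),
      measure_mono_null (fun x hx => not_not.1 hx.2) hpos, ENNReal.toReal_zero, zero_sub,
      neg_eq_zero, measureReal_eq_zero_iff] at h1
    rw [← measure_sdiff_null hneg, h1]

/-- Cancellation in a convex combination `(1 - t) • s₀ + t • s` of signed measures can shrink the
support below that of `s` only for countably many `t`. -/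
theorem countable_not_measSupport_subset [TopologicalSpace α] [SecondCountableTopology α]
    [OpensMeasurableSpace α] (s₀ s : SignedMeasure α) :
    {t : ℝ | ¬ measSupport s.totalVariation ⊆
      measSupport ((1 - t) • s₀ + t • s).totalVariation}.Countable := by
  have hB := TopologicalSpace.isBasis_countableBasis α
  refine Set.Countable.mono (s₂ := ⋃ U ∈ TopologicalSpace.countableBasis α,
    {t : ℝ | s.totalVariation U ≠ 0 ∧ ((1 - t) • s₀ + t • s).totalVariation U = 0}) ?_ ?_
  · intro t ht
    obtain ⟨x, hx, hxt⟩ := Set.not_subset.1 ht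
    simp only [measSupport, Set.mem_ofPred_eq, not_forall, not_not] at hxt
    obtain ⟨W, hW, hW0⟩ := hxt
    obtain ⟨U, hU, hxU, hUW⟩ := hB.mem_nhds_iff.1 hW
    exact Set.mem_biUnion hU ⟨hx U (hB.mem_nhds hU hxU), measure_mono_null hUW hW0⟩
  · refine (TopologicalSpace.countable_countableBasis α).biUnion fun U hU => ?_
    refine Set.Subsingleton.countable ?_
    rintro a ⟨ha, ha0⟩ b ⟨-, hb0⟩
    by_contra hab
    refine ha (totalVariation_eq_zero_of_forall (hB.isOpen hU).measurableSet fun B _ hBU => ?_)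
    have h1 := null_of_totalVariation_zero _ (measure_mono_null hBU ha0)
    have h2 := null_of_totalVariation_zero _ (measure_mono_null hBU hb0)
    simp only [_root_.add_apply, _root_.smul_apply, smul_eq_mul] at h1 h2
    have h3 : (a - b) * (s B - s₀ B) = 0 := by linarith
    have h4 := (mul_eq_zero.1 h3).resolve_left (sub_ne_zero.2 hab)
    linear_combination h1 + (1 - a) * h4

end MeasureTheory.SignedMeasure

theorem memLp_eval_of_isCompact {d : ℕ} {A : Set (Fin d → ℝ)} (hA : IsCompact A)
    {μ : Measure (Fin d → ℝ)} [IsFiniteMeasure μ] (hμ : μ Aᶜ = 0)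
    (p : MvPolynomial (Fin d) ℝ) (r : ℝ≥0∞) : MemLp (fun x => eval x p) r μ := by
  have hc : Continuous fun x : Fin d → ℝ => eval x p := MvPolynomial.continuous_eval p
  obtain ⟨C, hC⟩ := hA.exists_bound_of_continuousOn hc.continuousOn
  refine MemLp.of_bound hc.aestronglyMeasurable C ?_
  have hae : ∀ᵐ x ∂μ, x ∈ A := hμ
  filter_upwards [hae] with x hx using hC x hx

theorem sq_eval_le_of_predVar_le {d n : ℕ} {z0 : Fin d → ℝ} {μ : Measure (Fin d → ℝ)}
    {L : ℝ} (hL : 0 ≤ L) (h : predVar d n z0 μ ≤ ENNReal.ofReal L)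
    {p : MvPolynomial (Fin d) ℝ} (hp : p.totalDegree ≤ n) :
    (eval z0 p) ^ 2 ≤ L * ∫ x, (eval x p) ^ 2 ∂μ := by
  set c := ∫ x, (eval x p) ^ 2 ∂μ with hc
  have hc0 : 0 ≤ c := integral_nonneg fun x => sq_nonneg _
  have key : ∀ δ > 0, (eval z0 p) ^ 2 ≤ L * (c + δ) := by
    intro δ hδ
    set k := (√(c + δ))⁻¹ with hk
    have hk2 : k ^ 2 = (c + δ)⁻¹ := by rw [hk, inv_pow, Real.sq_sqrt (by positivity)]
    have hmem : ENNReal.ofReal ((eval z0 (C k * p)) ^ 2) ≤ predVar d n z0 μ := by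
      refine le_sSup ⟨C k * p, ?_, ?_, rfl⟩
      · exact (totalDegree_mul _ _).trans (by simpa using hp)
      · simp only [map_mul, eval_C, mul_pow, integral_const_mul, ← hc, hk2]
        rw [inv_mul_le_one₀ (by positivity)]
        linarith
    have h2 := (ENNReal.ofReal_le_ofReal_iff hL).1 (hmem.trans h)
    rw [map_mul, eval_C, mul_pow, hk2, inv_mul_le_iff₀ (by positivity)] at h2
    linarith
  refine le_of_forall_pos_le_add fun ε hε => ?_
  have h3 := key (ε / (L + 1)) (by positivity)
  have h4 : L * (ε / (L + 1)) ≤ ε := by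
    rw [mul_div_assoc', div_le_iff₀ (by positivity)]
    nlinarith
  linarith

/-- A linear functional that factors boundedly through a linear map into a Hilbert space is
represented by a vector. -/
theorem exists_inner_eq_of_abs_le {V H : Type*} [AddCommGroup V] [Module ℝ V]
    [NormedAddCommGroup H] [InnerProductSpace ℝ H] [CompleteSpace H] (T : V →ₗ[ℝ] H)
    (l : V →ₗ[ℝ] ℝ) {M : ℝ} (hM : 0 ≤ M) (h : ∀ v, |l v| ≤ M * ‖T v‖) :
    ∃ q : H, ‖q‖ ≤ M ∧ ∀ v, inner ℝ q (T v) = l v := by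
  have hker : LinearMap.ker T ≤ LinearMap.ker l := fun v hv => by
    have := h v
    rw [LinearMap.mem_ker.1 hv, norm_zero, mul_zero] at this
    exact abs_nonpos_iff.1 this
  let g : LinearMap.range T →ₗ[ℝ] ℝ :=
    (LinearMap.ker T).liftQ l hker ∘ₗ T.quotKerEquivRange.symm.toLinearMap
  have hg : ∀ v, g ⟨T v, v, rfl⟩ = l v := fun v => by
    have : T.quotKerEquivRange.symm ⟨T v, v, rfl⟩ = (LinearMap.ker T).mkQ v := by
      rw [LinearEquiv.symm_apply_eq]
      rfl
    simp [g, this]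
  have hb : ∀ y, ‖g y‖ ≤ M * ‖y‖ := by
    rintro ⟨_, v, rfl⟩
    rw [hg]
    exact h v
  obtain ⟨f, hf, hfn⟩ := exists_extension_norm_eq _ (g.mkContinuous M hb)
  refine ⟨(InnerProductSpace.toDual ℝ H).symm f, ?_, fun v => ?_⟩
  · rw [LinearIsometryEquiv.norm_map, hfn]
    exact g.mkContinuous_norm_le hM hb
  · rw [InnerProductSpace.toDual_symm_apply, ← hg v]
    exact hf ⟨T v, v, rfl⟩

/-- Finite prediction variance `L` yields a representing signed measure, absolutely continuous with
respect to `μ`, of total mass at most `√L`. -/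
theorem exists_representing_measures {d n : ℕ} {A : Set (Fin d → ℝ)} (hA : IsCompact A)
    {z0 : Fin d → ℝ} {μ : Measure (Fin d → ℝ)} [IsProbabilityMeasure μ] (hμ : μ Aᶜ = 0)
    {L : ℝ} (hL : 0 ≤ L) (h : predVar d n z0 μ ≤ ENNReal.ofReal L) :
    ∃ P N : Measure (Fin d → ℝ), P Aᶜ = 0 ∧ N Aᶜ = 0 ∧ (P + N) A ≤ ENNReal.ofReal √L ∧
      ∀ p : MvPolynomial (Fin d) ℝ, p.totalDegree ≤ n →
        (∫ x, eval x p ∂P) - (∫ x, eval x p ∂N) = eval z0 p := by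
  let T : restrictTotalDegree (Fin d) ℝ n →ₗ[ℝ] Lp ℝ 2 μ :=
    { toFun := fun p => (memLp_eval_of_isCompact hA hμ p.1 2).toLp
      map_add' := fun p q => by
        rw [← MemLp.toLp_add]
        exact MemLp.toLp_congr _ _ (Filter.Eventually.of_forall fun x => by simp)
      map_smul' := fun c p => by
        rw [RingHom.id_apply, ← MemLp.toLp_const_smul]
        exact MemLp.toLp_congr _ _ (Filter.Eventually.of_forall fun x => by simp) }
  let l : restrictTotalDegree (Fin d) ℝ n →ₗ[ℝ] ℝ :=
    (aeval z0).toLinearMap ∘ₗ (restrictTotalDegree (Fin d) ℝ n).subtype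
  have hl : ∀ p, l p = eval z0 p.1 := fun p => by simp [l, aeval_eq_eval]
  have hT : ∀ p, T p =ᵐ[μ] fun x => eval x p.1 := fun p =>
    MemLp.coeFn_toLp (memLp_eval_of_isCompact hA hμ p.1 2)
  have hnorm : ∀ p, ‖T p‖ ^ 2 = ∫ x, (eval x p.1) ^ 2 ∂μ := fun p => by
    rw [← real_inner_self_eq_norm_sq, L2.inner_def]
    refine integral_congr_ae ?_
    filter_upwards [hT p] with x hx
    simp [hx, sq]
  obtain ⟨q, hq, hrep⟩ := exists_inner_eq_of_abs_le T l (Real.sqrt_nonneg L) fun p => by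
    refine abs_le_of_sq_le_sq ?_ (by positivity)
    rw [mul_pow, Real.sq_sqrt hL, hnorm, hl]
    exact sq_eval_le_of_predVar_le hL h ((mem_restrictTotalDegree _ _ _).1 p.2)
  have hq2 : MemLp q 2 μ := Lp.memLp q
  have hqm : Measurable q := (Lp.stronglyMeasurable q).measurable
  have hqm' : Measurable fun x => -q x := hqm.neg
  refine ⟨μ.withDensity fun x => ENNReal.ofReal (q x), μ.withDensity fun x => ENNReal.ofReal (-q x),
    withDensity_absolutelyContinuous _ _ hμ, withDensity_absolutelyContinuous _ _ hμ, ?_, ?_⟩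
  · rw [← withDensity_add_left hqm.ennreal_ofReal]
    refine (measure_mono (Set.subset_univ A)).trans ?_
    rw [withDensity_apply _ MeasurableSet.univ, Measure.restrict_univ]
    calc _ = eLpNorm q 1 μ := by
          rw [eLpNorm_one_eq_lintegral_enorm]
          refine lintegral_congr fun x => ?_
          rw [Pi.add_apply, Real.enorm_eq_ofReal_abs]
          rcases le_total 0 (q x) with h0 | h0
          · rw [ENNReal.ofReal_of_nonpos (neg_nonpos.2 h0), add_zero, abs_of_nonneg h0]
          · rw [ENNReal.ofReal_of_nonpos h0, zero_add, abs_of_nonpos h0]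
      _ ≤ eLpNorm q 2 μ := eLpNorm_le_eLpNorm_of_exponent_le one_le_two hq2.1
      _ = ENNReal.ofReal ‖q‖ := by
          rw [Lp.norm_def, ENNReal.ofReal_toReal hq2.2.ne]
      _ ≤ _ := ENNReal.ofReal_le_ofReal hq
  · intro p hp
    have hpL := memLp_eval_of_isCompact hA hμ p 2
    rw [integral_withDensity_eq_integral_toReal_smul hqm.ennreal_ofReal
        (Filter.Eventually.of_forall fun _ => ENNReal.ofReal_lt_top),
      integral_withDensity_eq_integral_toReal_smul hqm'.ennreal_ofReal
        (Filter.Eventually.of_forall fun _ => ENNReal.ofReal_lt_top)]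
    simp only [ENNReal.toReal_ofReal', smul_eq_mul]
    have h1 : Integrable (fun x => max (q x) 0 * eval x p) μ := hq2.pos_part.integrable_mul hpL
    have h2 : Integrable (fun x => max (-q x) 0 * eval x p) μ := hq2.neg_part.integrable_mul hpL
    rw [← integral_sub h1 h2]
    have hr := hrep ⟨p, (mem_restrictTotalDegree _ _ _).2 hp⟩
    rw [hl, L2.inner_def] at hr
    rw [← hr]
    refine integral_congr_ae ?_
    filter_upwards [hT ⟨p, (mem_restrictTotalDegree _ _ _).2 hp⟩] with x hx
    simp only [hx, RCLike.inner_apply, conj_trivial]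
    rw [← sub_mul, max_zero_sub_max_neg_zero_eq_self, mul_comm]

/-- By Cauchy–Schwarz, the normalised total variation of a representing signed measure has
prediction variance at most the squared total variation. -/
theorem predVar_smul_totalVariation_le {d n : ℕ} {A : Set (Fin d → ℝ)} (hA : IsCompact A)
    {z0 : Fin d → ℝ} {ν : SignedMeasure (Fin d → ℝ)} (hν : ν.totalVariation Aᶜ = 0)
    (hrep : ∀ p : MvPolynomial (Fin d) ℝ, p.totalDegree ≤ n →
      (∫ x, eval x p ∂ν.toJordanDecomposition.posPart) -
        (∫ x, eval x p ∂ν.toJordanDecomposition.negPart) = eval z0 p)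
    {m : Measure (Fin d → ℝ)} [IsProbabilityMeasure m] {V : ℝ} (hV : 0 ≤ V)
    (hm : ν.totalVariation = ENNReal.ofReal V • m) (hmA : m Aᶜ = 0) :
    predVar d n z0 m ≤ ENNReal.ofReal (V ^ 2) := by
  refine sSup_le ?_
  rintro _ ⟨p, hp, hp1, rfl⟩
  refine ENNReal.ofReal_le_ofReal ?_
  have hνfin : IsFiniteMeasure ν.totalVariation := by
    rw [SignedMeasure.totalVariation]
    infer_instance
  have hint : Integrable (fun x => |eval x p|) ν.totalVariation :=
    (memLp_one_iff_integrable.1 (memLp_eval_of_isCompact hA hν p 1)).abs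
  have h1 : |eval z0 p| ≤ V * ∫ x, |eval x p| ∂m := by
    calc |eval z0 p| ≤ |∫ x, eval x p ∂ν.toJordanDecomposition.posPart| +
          |∫ x, eval x p ∂ν.toJordanDecomposition.negPart| := by
          rw [← hrep p hp]
          exact abs_sub _ _
      _ ≤ (∫ x, |eval x p| ∂ν.toJordanDecomposition.posPart) +
          ∫ x, |eval x p| ∂ν.toJordanDecomposition.negPart :=
          add_le_add abs_integral_le_integral_abs abs_integral_le_integral_abs
      _ = ∫ x, |eval x p| ∂ν.totalVariation :=
          (integral_add_measure hint.left_of_add_measure hint.right_of_add_measure).symm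
      _ = V * ∫ x, |eval x p| ∂m := by
          rw [hm, integral_smul_measure, ENNReal.toReal_ofReal hV, smul_eq_mul]
  have hm2 := memLp_eval_of_isCompact hA hmA p 2
  have h2 : (∫ x, |eval x p| ∂m) ^ 2 ≤ ∫ x, (eval x p) ^ 2 ∂m := by
    have := ProbabilityTheory.variance_nonneg |fun x => eval x p| m
    rw [ProbabilityTheory.variance_eq_sub hm2.abs] at this
    simpa [sq_abs] using this
  have h3 : (eval z0 p) ^ 2 ≤ (V * ∫ x, |eval x p| ∂m) ^ 2 := by
    rw [← sq_abs]
    exact pow_le_pow_left₀ (abs_nonneg _) h1 2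
  rw [mul_pow] at h3
  nlinarith [sq_nonneg V]

/-- A signed measure of minimal total variation, among the representing ones whose support contains
`S`, has total variation at most the mass of any representing pair of measures: the support
constraint costs nothing. -/
theorem totalVariation_le_of_minimal {d n : ℕ} {A S : Set (Fin d → ℝ)} (hA : IsCompact A)
    {z0 : Fin d → ℝ} {ν : SignedMeasure (Fin d → ℝ)} (hν : ν.totalVariation Aᶜ = 0)
    (hrep : ∀ p : MvPolynomial (Fin d) ℝ, p.totalDegree ≤ n →
      (∫ x, eval x p ∂ν.toJordanDecomposition.posPart) -
        (∫ x, eval x p ∂ν.toJordanDecomposition.negPart) = eval z0 p)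
    (hS : S ⊆ measSupport ν.totalVariation)
    (hmin : ∀ η : SignedMeasure (Fin d → ℝ), η.totalVariation Aᶜ = 0 →
      (∀ p : MvPolynomial (Fin d) ℝ, p.totalDegree ≤ n →
        (∫ x, eval x p ∂η.toJordanDecomposition.posPart) -
          (∫ x, eval x p ∂η.toJordanDecomposition.negPart) = eval z0 p) →
      S ⊆ measSupport η.totalVariation → ν.totalVariation A ≤ η.totalVariation A)
    {P N : Measure (Fin d → ℝ)} [IsFiniteMeasure P] [IsFiniteMeasure N]
    (hP : P Aᶜ = 0) (hN : N Aᶜ = 0)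
    (hPN : ∀ p : MvPolynomial (Fin d) ℝ, p.totalDegree ≤ n →
      (∫ x, eval x p ∂P) - (∫ x, eval x p ∂N) = eval z0 p) :
    ν.totalVariation A ≤ (P + N) A := by
  obtain ⟨t, ht, ht0, ht1⟩ : ∃ t : ℝ, S ⊆ measSupport ((1 - t) •
      (P.toSignedMeasure - N.toSignedMeasure) + t • ν).totalVariation ∧ 0 < t ∧ t < 1 := by
    obtain ⟨t, ht, h01⟩ := (SignedMeasure.countable_not_measSupport_subset
      (P.toSignedMeasure - N.toSignedMeasure) ν).dense_compl ℝ |>.exists_mem_open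
        (isOpen_Ioo (a := (0 : ℝ)) (b := 1)) ⟨1 / 2, by norm_num, by norm_num⟩
    exact ⟨t, hS.trans (not_not.1 ht), h01⟩
  lift t to NNReal using ht0.le
  obtain ⟨u, hu⟩ : ∃ u : NNReal, (u : ℝ) = 1 - t := ⟨⟨1 - t, by linarith⟩, rfl⟩
  have hu0 : 0 < (u : ℝ) := by linarith
  rw [← hu] at ht
  set J := ν.toJordanDecomposition
  have hsum : J.posPart Aᶜ + J.negPart Aᶜ = 0 := hν
  obtain ⟨hJp, hJn⟩ := add_eq_zero.1 hsum
  have hη : (u : ℝ) • (P.toSignedMeasure - N.toSignedMeasure) + (t : ℝ) • ν =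
      (u • P + t • J.posPart).toSignedMeasure - (u • N + t • J.negPart).toSignedMeasure := by
    have hνJ : ν = J.posPart.toSignedMeasure - J.negPart.toSignedMeasure :=
      ν.toSignedMeasure_toJordanDecomposition.symm
    rw [Measure.toSignedMeasure_add, Measure.toSignedMeasure_add, Measure.toSignedMeasure_smul,
      Measure.toSignedMeasure_smul, Measure.toSignedMeasure_smul, Measure.toSignedMeasure_smul]
    conv_lhs => rw [hνJ]
    simp only [NNReal.smul_def, smul_sub]
    abel
  have hle := SignedMeasure.totalVariation_le hη
  have hintA : ∀ (m : Measure (Fin d → ℝ)) [IsFiniteMeasure m], m Aᶜ = 0 →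
      ∀ p : MvPolynomial (Fin d) ℝ, Integrable (fun x => eval x p) m := fun m _ h p =>
    memLp_one_iff_integrable.1 (memLp_eval_of_isCompact hA h p 1)
  have hmin' := hmin _ (le_zero_iff.1 ((hle Aᶜ).trans (by simp [hP, hN, hJp, hJn]))) (fun p hp => by
    rw [SignedMeasure.integral_posPart_sub_integral_negPart hη
        (hintA _ (by simp [hP, hJp]) p) (hintA _ (by simp [hN, hJn]) p),
      integral_add_measure ((hintA P hP p).smul_measure_nnreal)
        ((hintA _ hJp p).smul_measure_nnreal),
      integral_add_measure ((hintA N hN p).smul_measure_nnreal)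
        ((hintA _ hJn p).smul_measure_nnreal)]
    simp only [integral_smul_nnreal_measure, NNReal.smul_def, smul_eq_mul]
    linear_combination (u : ℝ) * hPN p hp + (t : ℝ) * hrep p hp + eval z0 p * hu) ht
  have hmain := hmin'.trans (hle A)
  have hrew : ((u • P + t • J.posPart) + (u • N + t • J.negPart)) A =
      u * (P + N) A + t * ν.totalVariation A := by
    rw [SignedMeasure.totalVariation]
    simp only [Measure.add_apply, Measure.smul_apply, ENNReal.smul_def, smul_eq_mul]
    ring
  rw [hrew] at hmain
  have hVfin : ν.totalVariation A ≠ ∞ := by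
    rw [SignedMeasure.totalVariation]
    exact measure_ne_top _ _
  have hWfin : (P + N) A ≠ ∞ := measure_ne_top _ _
  lift ν.totalVariation A to NNReal using hVfin with V
  lift (P + N) A to NNReal using hWfin with W
  norm_cast at hmain ⊢
  rw [← NNReal.coe_le_coe] at hmain ⊢
  push_cast at hmain
  nlinarith

/-- **Theorem 4.1: optimal prediction measures via total-variation minimization.**
Let `A ⊂ ℝᵈ` be compact, `z₀ ∉ A`, `n ≥ 1`.  Suppose `μ₀` is a probability measure on
`A` minimizing `Λ_n`, and `ν*` minimizes the total variation `|ν|(A)` among all finite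
signed Borel measures `ν` supported in `A` which represent evaluation at `z₀` on
polynomials of degree at most `n` and whose support contains that of `μ₀`.  Then the
probability measure `μ_n = |ν*|/|ν*|(A)` minimizes `Λ_n` among probability measures on
`A`, and `Λ_n(μ_n) = (|ν*|(A))²`. -/
theorem optimal_prediction_measure_via_total_variation (d n : ℕ) (hn : 1 ≤ n)
    (A : Set (Fin d → ℝ)) (hA : IsCompact A)
    (z0 : Fin d → ℝ) (hz0 : z0 ∉ A)
    -- a probability measure `μ₀` on `A` minimizing `Λ_n`
    (μ0 : MeasureTheory.Measure (Fin d → ℝ)) [IsProbabilityMeasure μ0] (hμ0A : μ0 Aᶜ = 0)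
    (hμ0min : ∀ μ : MeasureTheory.Measure (Fin d → ℝ), IsProbabilityMeasure μ → μ Aᶜ = 0 →
      predVar d n z0 μ0 ≤ predVar d n z0 μ)
    -- `ν*` belongs to the competing class …
    (νstar : MeasureTheory.SignedMeasure (Fin d → ℝ))
    (hν_supp : νstar.totalVariation Aᶜ = 0)
    (hν_rep : ∀ p : MvPolynomial (Fin d) ℝ, p.totalDegree ≤ n →
      (∫ x, MvPolynomial.eval x p ∂νstar.toJordanDecomposition.posPart) -
        (∫ x, MvPolynomial.eval x p ∂νstar.toJordanDecomposition.negPart) =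
        MvPolynomial.eval z0 p)
    (hν_cont : measSupport μ0 ⊆ measSupport νstar.totalVariation)
    -- … and minimizes the total variation `|ν|(A)` within that class
    (hν_min : ∀ ν : MeasureTheory.SignedMeasure (Fin d → ℝ),
      ν.totalVariation Aᶜ = 0 →
      (∀ p : MvPolynomial (Fin d) ℝ, p.totalDegree ≤ n →
        (∫ x, MvPolynomial.eval x p ∂ν.toJordanDecomposition.posPart) -
          (∫ x, MvPolynomial.eval x p ∂ν.toJordanDecomposition.negPart) =
          MvPolynomial.eval z0 p) →
      measSupport μ0 ⊆ measSupport ν.totalVariation →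
      νstar.totalVariation A ≤ ν.totalVariation A) :
    (∀ μ : MeasureTheory.Measure (Fin d → ℝ), IsProbabilityMeasure μ → μ Aᶜ = 0 →
      predVar d n z0 ((νstar.totalVariation A)⁻¹ • νstar.totalVariation) ≤
        predVar d n z0 μ) ∧
    predVar d n z0 ((νstar.totalVariation A)⁻¹ • νstar.totalVariation) =
      (νstar.totalVariation A) ^ 2 := by
  have hV_top : νstar.totalVariation A ≠ ∞ := by
    rw [SignedMeasure.totalVariation]
    exact measure_ne_top _ _
  have huniv : νstar.totalVariation Set.univ = νstar.totalVariation A :=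
    (measure_congr (ae_eq_univ.2 hν_supp)).symm
  have hV_ne : νstar.totalVariation A ≠ 0 := fun h0 => by
    rw [← huniv, SignedMeasure.totalVariation, Measure.add_apply, add_eq_zero,
      Measure.measure_univ_eq_zero, Measure.measure_univ_eq_zero] at h0
    have := hν_rep 1 (by simp)
    simp [h0.1, h0.2] at this
  set V := νstar.totalVariation A with hVdef
  set m := V⁻¹ • νstar.totalVariation with hm
  have : IsProbabilityMeasure m := ⟨by
    rw [hm, Measure.smul_apply, huniv, smul_eq_mul, ENNReal.inv_mul_cancel hV_ne hV_top]⟩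
  have hmA : m Aᶜ = 0 := by rw [hm, Measure.smul_apply, hν_supp, smul_zero]
  have hTV : νstar.totalVariation = ENNReal.ofReal V.toReal • m := by
    rw [ENNReal.ofReal_toReal hV_top, hm, smul_smul, ENNReal.mul_inv_cancel hV_ne hV_top, one_smul]
  have hle : predVar d n z0 m ≤ V ^ 2 := by
    have := predVar_smul_totalVariation_le hA hν_supp hν_rep ENNReal.toReal_nonneg hTV hmA
    rwa [ENNReal.ofReal_pow ENNReal.toReal_nonneg, ENNReal.ofReal_toReal hV_top] at this
  have h0m := hμ0min m this hmA
  have hfin : predVar d n z0 μ0 ≠ ∞ :=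
    ((h0m.trans hle).trans_lt (ENNReal.pow_lt_top hV_top.lt_top)).ne
  obtain ⟨P, N, hP, hN, hPNA, hPN⟩ := exists_representing_measures (n := n) (z0 := z0) hA hμ0A
    (L := (predVar d n z0 μ0).toReal) ENNReal.toReal_nonneg (ENNReal.ofReal_toReal hfin).ge
  have hfinPN : IsFiniteMeasure (P + N) := ⟨by
    rw [← measure_congr (ae_eq_univ.2 (show (P + N) Aᶜ = 0 by simp [hP, hN]))]
    exact hPNA.trans_lt ENNReal.ofReal_lt_top⟩
  have hfP : IsFiniteMeasure P := isFiniteMeasure_of_le (P + N) (Measure.le_add_right le_rfl)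
  have hfN : IsFiniteMeasure N := isFiniteMeasure_of_le (P + N) (Measure.le_add_left le_rfl)
  have hVle := (totalVariation_le_of_minimal hA hν_supp hν_rep hν_cont hν_min hP hN hPN).trans hPNA
  have hge : V ^ 2 ≤ predVar d n z0 μ0 := by
    refine (pow_le_pow_left' hVle 2).trans_eq ?_
    rw [← ENNReal.ofReal_pow (Real.sqrt_nonneg _), Real.sq_sqrt ENNReal.toReal_nonneg,
      ENNReal.ofReal_toReal hfin]
  exact ⟨fun μ hμ hμA => hle.trans (hge.trans (hμ0min μ hμ hμA)),
    le_antisymm hle (hge.trans h0m)⟩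
end
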